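/- arXiv:2503.17567 — 3 statements merged into one kernel-verified Lean document; each statement's English description precedes it below -/
import Mathlib

section
/- For every λ > 0 and every u in X_{λ,0} one has the improved scale-dependent Gaussian Poincaré inequality: ∫_{ℝ^N} |∇u|² dμ_λ ≥ (1/λ²) inf over c ∈ ℝ and d ∈ ℝ^N of ∫_{ℝ^N} ( |u − c|² + |u − c − d·x|² ) dμ_λ. -/
open MeasureTheory Real

noncomputable section

/-- The scale-dependent Gaussian probability measure
`dμ_λ = e^{-|x|²/(2λ²)} dx / ∫_{ℝ^N} e^{-|x|²/(2λ²)} dx` on `ℝ^N`. -/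
def gaussScaled (N : ℕ) (lam : ℝ) : Measure (EuclideanSpace ℝ (Fin N)) :=
  ((MeasureTheory.volume.withDensity
      (fun x : EuclideanSpace ℝ (Fin N) =>
        ENNReal.ofReal (Real.exp (-‖x‖ ^ 2 / (2 * lam ^ 2))))) Set.univ)⁻¹ •
  (MeasureTheory.volume.withDensity
      (fun x : EuclideanSpace ℝ (Fin N) =>
        ENNReal.ofReal (Real.exp (-‖x‖ ^ 2 / (2 * lam ^ 2)))))

end

open ProbabilityTheory SchwartzMap FourierTransform LineDeriv
open scoped ComplexConjugate RealInnerProductSpace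

theorem isProbabilityMeasure_and_charFun_gaussScaled (N : ℕ) {lam : ℝ} (hlam : 0 < lam) :
    IsProbabilityMeasure (gaussScaled N lam) ∧
    (∀ t, charFun (gaussScaled N lam) t = Complex.exp (-(lam ^ 2 * ‖t‖ ^ 2 / 2 : ℝ))) := by
  set ρ : EuclideanSpace ℝ (Fin N) → ℝ := fun x => Real.exp (-‖x‖ ^ 2 / (2 * lam ^ 2)) with hρ
  have hb : 0 < 1 / (2 * lam ^ 2) := by positivity
  have hρ' : ∀ x, ρ x = Real.exp (-(1 / (2 * lam ^ 2)) * ‖x‖ ^ 2) := fun x => by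
    simp only [hρ]; congr 1; ring
  have hρc : Continuous ρ := by simp only [hρ]; fun_prop
  have hZ : 0 < ∫ x, ρ x := by
    simp_rw [hρ']
    rw [GaussianFourier.integral_rexp_neg_mul_sq_norm hb]
    positivity
  have hρi : Integrable ρ := by
    by_contra h
    rw [integral_undef h] at hZ
    exact lt_irrefl _ hZ
  have hmass : (volume.withDensity fun x => ENNReal.ofReal (ρ x)) Set.univ
      = ENNReal.ofReal (∫ x, ρ x) := by
    rw [withDensity_apply _ MeasurableSet.univ, Measure.restrict_univ,
      ofReal_integral_eq_lintegral_ofReal hρi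
        (Filter.Eventually.of_forall fun x => (Real.exp_pos _).le)]
  have hdef : gaussScaled N lam = (ENNReal.ofReal (∫ x, ρ x))⁻¹ •
      (volume.withDensity fun x => ENNReal.ofReal (ρ x)) := by
    rw [← hmass]; rfl
  refine ⟨⟨?_⟩, fun t => ?_⟩
  · rw [hdef, Measure.smul_apply, hmass, smul_eq_mul, ENNReal.inv_mul_cancel (by simpa using hZ)
      ENNReal.ofReal_ne_top]
  · rw [charFun_apply, hdef, integral_smul_measure,
      integral_withDensity_eq_integral_toReal_smul (by fun_prop) (by simp)]
    have h1 := GaussianFourier.integral_cexp_neg_mul_sq_norm_add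
      (b := ((1 / (2 * lam ^ 2) : ℝ) : ℂ)) (by rwa [Complex.ofReal_re]) Complex.I t
    have h0 := GaussianFourier.integral_cexp_neg_mul_sq_norm (V := EuclideanSpace ℝ (Fin N))
      (b := ((1 / (2 * lam ^ 2) : ℝ) : ℂ)) (by rwa [Complex.ofReal_re])
    have h2 : ∫ x, (ENNReal.ofReal (ρ x)).toReal • Complex.exp (⟪x, t⟫ * Complex.I)
        = (∫ x, ρ x : ℝ) * Complex.exp (-(lam ^ 2 * ‖t‖ ^ 2 / 2 : ℝ)) := by
      have e1 : ∀ x, (ENNReal.ofReal (ρ x)).toReal • Complex.exp (⟪x, t⟫ * Complex.I)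
          = Complex.exp (-((1 / (2 * lam ^ 2) : ℝ) : ℂ) * ‖x‖ ^ 2 + Complex.I * ⟪t, x⟫) := by
        intro x
        rw [hρ', ENNReal.toReal_ofReal (Real.exp_pos _).le, Complex.exp_add, real_inner_comm,
          mul_comm Complex.I, Complex.real_smul]
        push_cast
        rfl
      have e2 : ((∫ x, ρ x : ℝ) : ℂ)
          = ∫ x : EuclideanSpace ℝ (Fin N),
            Complex.exp (-((1 / (2 * lam ^ 2) : ℝ) : ℂ) * ‖x‖ ^ 2) := by
        rw [← integral_complex_ofReal]
        congr 1; ext x; rw [hρ']; push_cast; rfl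
      simp_rw [e1]
      rw [e2, h1, h0]
      congr 2
      have : (lam : ℂ) ≠ 0 := by exact_mod_cast hlam.ne'
      push_cast
      simp only [Complex.I_sq]
      field_simp
      norm_num
    rw [h2, ENNReal.toReal_inv, ENNReal.toReal_ofReal hZ.le, Complex.real_smul, ← mul_assoc,
      Complex.ofReal_inv, inv_mul_cancel₀ (by exact_mod_cast hZ.ne'), one_mul]

/-- The scaled Gaussian measure is the dilation by `lam` of the standard Gaussian measure. -/
theorem gaussScaled_eq_map_stdGaussian (N : ℕ) {lam : ℝ} (hlam : 0 < lam) :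
    gaussScaled N lam = (stdGaussian (EuclideanSpace ℝ (Fin N))).map (lam • ·) := by
  have h := isProbabilityMeasure_and_charFun_gaussScaled N hlam
  have := h.1
  have : IsProbabilityMeasure ((stdGaussian (EuclideanSpace ℝ (Fin N))).map (lam • ·)) :=
    Measure.isProbabilityMeasure_map (by fun_prop)
  refine Measure.ext_of_charFun (funext fun t => ?_)
  rw [h.2, charFun_map_smul, charFun_stdGaussian, norm_smul, Real.norm_eq_abs]
  push_cast
  rw [mul_pow, ← Complex.ofReal_pow |lam|, sq_abs]
  push_cast
  ring_nf

section FourierKernel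

variable {N : ℕ}

/-- Fubini's theorem for superpositions of characters against a finite measure. -/
theorem integral_integral_cexp_inner_mul {α : Type*} [MeasureSpace α]
    [SFinite (volume : Measure α)] (μ : Measure (EuclideanSpace ℝ (Fin N))) [IsFiniteMeasure μ]
    {L : α → EuclideanSpace ℝ (Fin N)} (hL : Measurable L) {ψ : α → ℂ} (hψ : Integrable ψ) :
    ∫ x, (∫ p, Complex.exp (⟪x, L p⟫ * Complex.I) * ψ p) ∂μ = ∫ p, charFun μ (L p) * ψ p := by
  rw [integral_integral_swap]
  · simp_rw [integral_mul_const, charFun_apply]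
  · have h : Integrable (fun q : EuclideanSpace ℝ (Fin N) × α => (1 : ℂ) * ψ q.2) (μ.prod volume) :=
      (integrable_const (1 : ℂ)).mul_prod hψ
    have hc : Continuous fun q : ℝ => Complex.exp (q * Complex.I) := by fun_prop
    refine (h.bdd_mul (c := 1) (f := fun q => Complex.exp (⟪q.1, L q.2⟫ * Complex.I)) ?_ ?_).congr
      (Filter.Eventually.of_forall fun q => by simp [Function.uncurry])
    · exact (hc.measurable.comp (by fun_prop)).aestronglyMeasurable
    · exact Filter.Eventually.of_forall fun q => (Complex.norm_exp_ofReal_mul_I _).le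

theorem integrable_conj_of_integrable {α : Type*} [MeasurableSpace α] {μ : Measure α} {h : α → ℂ}
    (hh : Integrable h μ) : Integrable (fun x => conj (h x)) μ :=
  Complex.conjCLE.toContinuousLinearMap.integrable_comp hh

theorem integral_prod_mul_conj {α : Type*} [MeasureSpace α] [SFinite (volume : Measure α)]
    (g : α → ℂ) :
    ∫ p : α × α, g p.1 * conj (g p.2) = (∫ ξ, g ξ) * conj (∫ ξ, g ξ) := by
  rw [← integral_conj]
  exact integral_prod_mul g fun ξ => conj (g ξ)

/-- The kernels `⟪x, y⟫ ^ k` are positive semidefinite. -/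
theorem integral_mul_conj_mul_inner_pow_re_nonneg {h : EuclideanSpace ℝ (Fin N) → ℂ}
    (hm : AEStronglyMeasurable h)
    (hh : ∀ k : ℕ, Integrable fun ξ => ‖ξ‖ ^ k * ‖h ξ‖) (k : ℕ) :
    0 ≤ (∫ p : EuclideanSpace ℝ (Fin N) × EuclideanSpace ℝ (Fin N),
      h p.1 * conj (h p.2) * (⟪p.1, p.2⟫ : ℝ) ^ k).re := by
  set H : (Fin k → Fin N) → EuclideanSpace ℝ (Fin N) → ℂ :=
    fun a ξ => (∏ i, (ξ (a i) : ℂ)) * h ξ with hH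
  have hHi : ∀ a, Integrable (H a) := fun a => by
    refine (hh k).mono' ?_ (Filter.Eventually.of_forall fun ξ => ?_)
    · refine (Continuous.aestronglyMeasurable ?_).mul hm
      fun_prop
    · simp only [hH, norm_mul, norm_prod, Complex.norm_real]
      gcongr
      calc ∏ i, ‖ξ (a i)‖ ≤ ∏ _i : Fin k, ‖ξ‖ :=
            Finset.prod_le_prod (fun _ _ => norm_nonneg _) fun i _ => PiLp.norm_apply_le ξ (a i)
        _ = ‖ξ‖ ^ k := by simp
  have hsum : ∀ p : EuclideanSpace ℝ (Fin N) × EuclideanSpace ℝ (Fin N),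
      h p.1 * conj (h p.2) * (⟪p.1, p.2⟫ : ℝ) ^ k = ∑ a, H a p.1 * conj (H a p.2) := by
    intro p
    have : ((⟪p.1, p.2⟫ : ℝ) : ℂ) = ∑ j, (p.1 j : ℂ) * (p.2 j : ℂ) := by
      rw [PiLp.inner_apply]; push_cast
      simp [mul_comm]
    rw [this, Fintype.sum_pow, Finset.mul_sum]
    refine Finset.sum_congr rfl fun a _ => ?_
    simp only [hH, Finset.prod_mul_distrib, map_mul, map_prod, Complex.conj_ofReal]
    ring
  simp_rw [hsum]
  have hprod : ∀ a, Integrable fun p : EuclideanSpace ℝ (Fin N) × EuclideanSpace ℝ (Fin N) =>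
      H a p.1 * conj (H a p.2) := fun a =>
    (hHi a).mul_prod (integrable_conj_of_integrable (hHi a))
  rw [integral_finsetSum _ fun a _ => hprod a, Complex.re_sum]
  refine Finset.sum_nonneg fun a _ => ?_
  rw [integral_prod_mul_conj, Complex.mul_conj]
  exact Complex.normSq_nonneg _

/-- Coefficients of the power series of `t * exp t - 2 * exp t + 2 + t`. -/
noncomputable def spectralCoeff (k : ℕ) : ℝ := (k - 2) / k.factorial + (if k = 0 then 2 else 0) +
  (if k = 1 then 1 else 0)

theorem spectralCoeff_nonneg (k : ℕ) : 0 ≤ spectralCoeff k := by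
  rcases k with _ | _ | k
  · simp [spectralCoeff]
  · norm_num [spectralCoeff]
  · simp only [spectralCoeff]
    have : (0 : ℝ) ≤ ((k + 1 + 1 : ℕ) : ℝ) - 2 := by
      push_cast; linarith [(k.cast_nonneg : (0 : ℝ) ≤ k)]
    simp only [Nat.add_eq_zero_iff, one_ne_zero, and_false, if_false, Nat.add_eq_right, add_zero]
    exact div_nonneg this (by positivity)

theorem hasSum_spectralCoeff (t : ℝ) :
    HasSum (fun k => spectralCoeff k * t ^ k)
      (t * Real.exp t - 2 * Real.exp t + 2 + t) := by
  have h1 : HasSum (fun k : ℕ => t ^ k / k.factorial) (Real.exp t) := by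
    rw [Real.exp_eq_exp_ℝ]; exact NormedSpace.expSeries_div_hasSum_exp t
  have h2 : HasSum (fun k : ℕ => k * (t ^ k / k.factorial)) (t * Real.exp t) := by
    rw [← hasSum_nat_add_iff' 1]
    simp only [Finset.range_one, Finset.sum_singleton, Nat.cast_zero, zero_mul, sub_zero]
    refine (h1.mul_left t).congr_fun fun k => ?_
    have : (k.factorial : ℝ) ≠ 0 := by positivity
    rw [Nat.factorial_succ]; push_cast
    field_simp
    ring
  have h3 : HasSum (fun k : ℕ => if k = 0 then (2 : ℝ) else 0) 2 := hasSum_ite_eq 0 2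
  have h4 : HasSum (fun k : ℕ => if k = 1 then t else 0) t := hasSum_ite_eq 1 t
  refine (((h2.sub (h1.mul_left 2)).add h3).add h4).congr_fun fun k => ?_
  rcases k with _ | _ | k <;> simp [spectralCoeff] <;> ring

theorem hasSum_integral_spectralCoeff {h : EuclideanSpace ℝ (Fin N) → ℂ} (hc : Continuous h)
    {φ : EuclideanSpace ℝ (Fin N) → ℂ} (h0 : Integrable fun ξ => ‖φ ξ‖)
    (h1 : Integrable fun ξ => ‖ξ‖ * ‖φ ξ‖) {s : ℝ} (hs : 0 ≤ s)
    (hle : ∀ ξ, ‖h ξ‖ ≤ Real.exp (-(s * ‖ξ‖ ^ 2 / 2)) * ‖φ ξ‖) :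
    HasSum (fun k => ∫ p : EuclideanSpace ℝ (Fin N) × EuclideanSpace ℝ (Fin N),
        h p.1 * conj (h p.2) * (spectralCoeff k * (s * ⟪p.1, p.2⟫) ^ k : ℝ))
      (∫ p : EuclideanSpace ℝ (Fin N) × EuclideanSpace ℝ (Fin N),
        h p.1 * conj (h p.2) * ((s * ⟪p.1, p.2⟫) * Real.exp (s * ⟪p.1, p.2⟫)
          - 2 * Real.exp (s * ⟪p.1, p.2⟫) + 2 + s * ⟪p.1, p.2⟫ : ℝ)) := by
  have hbs : ∀ p : EuclideanSpace ℝ (Fin N) × EuclideanSpace ℝ (Fin N),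
      HasSum (fun k => ‖h p.1‖ * ‖h p.2‖ * (spectralCoeff k * |s * ⟪p.1, p.2⟫| ^ k)) _ := fun p =>
    (hasSum_spectralCoeff |s * ⟪p.1, p.2⟫|).mul_left (‖h p.1‖ * ‖h p.2‖)
  refine hasSum_integral_of_dominated_convergence
    (fun k (p : EuclideanSpace ℝ (Fin N) × EuclideanSpace ℝ (Fin N)) =>
      ‖h p.1‖ * ‖h p.2‖ * (spectralCoeff k * |s * ⟪p.1, p.2⟫| ^ k)) ?_ ?_ ?_ ?_ ?_
  · intro k
    exact Continuous.aestronglyMeasurable (by fun_prop)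
  · refine fun k => Filter.Eventually.of_forall fun p => le_of_eq ?_
    simp [abs_mul, abs_of_nonneg (spectralCoeff_nonneg k)]
  · exact Filter.Eventually.of_forall fun p => (hbs p).summable
  · simp_rw [fun p => (hbs p).tsum_eq]
    have hdom : Integrable fun p : EuclideanSpace ℝ (Fin N) × EuclideanSpace ℝ (Fin N) =>
        2 * s * ((‖p.1‖ * ‖φ p.1‖) * (‖p.2‖ * ‖φ p.2‖)) + 2 * (‖φ p.1‖ * ‖φ p.2‖) :=
      ((h1.mul_prod h1).const_mul _).add ((h0.mul_prod h0).const_mul _)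
    refine hdom.mono' (Continuous.aestronglyMeasurable (by fun_prop))
      (Filter.Eventually.of_forall fun p => ?_)
    set t := |s * ⟪p.1, p.2⟫| with ht
    have ht0 : 0 ≤ t := abs_nonneg _
    have hts : t ≤ s * (‖p.1‖ * ‖p.2‖) := by
      rw [ht, abs_mul, abs_of_nonneg hs]
      exact mul_le_mul_of_nonneg_left (abs_real_inner_le_norm _ _) hs
    have hpos : 0 ≤ t * Real.exp t - 2 * Real.exp t + 2 + t :=
      (hasSum_spectralCoeff t).nonneg fun k => mul_nonneg (spectralCoeff_nonneg k) (by positivity)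
    rw [Real.norm_of_nonneg (by positivity)]
    set E := Real.exp (-(s * ‖p.1‖ ^ 2 / 2)) * Real.exp (-(s * ‖p.2‖ ^ 2 / 2)) with hE
    have hE1 : E ≤ 1 := by
      rw [hE, ← Real.exp_add, Real.exp_le_one_iff]
      nlinarith [mul_nonneg hs (sq_nonneg ‖p.1‖), mul_nonneg hs (sq_nonneg ‖p.2‖)]
    have hE2 : E * Real.exp t ≤ 1 := by
      rw [hE, ← Real.exp_add, ← Real.exp_add, Real.exp_le_one_iff]
      nlinarith [mul_nonneg hs (sq_nonneg (‖p.1‖ - ‖p.2‖))]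
    have hE0 : 0 ≤ E := by positivity
    have hhh : ‖h p.1‖ * ‖h p.2‖ ≤ E * (‖φ p.1‖ * ‖φ p.2‖) := by
      calc _ ≤ (Real.exp (-(s * ‖p.1‖ ^ 2 / 2)) * ‖φ p.1‖) *
            (Real.exp (-(s * ‖p.2‖ ^ 2 / 2)) * ‖φ p.2‖) :=
            mul_le_mul (hle _) (hle _) (norm_nonneg _) (by positivity)
        _ = _ := by rw [hE]; ring
    have hEg : E * (t * Real.exp t - 2 * Real.exp t + 2 + t) ≤ 2 * t + 2 := by
      nlinarith [mul_le_mul_of_nonneg_left hE2 ht0, mul_le_mul_of_nonneg_left hE1 ht0,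
        mul_nonneg hE0 (Real.exp_pos t).le]
    calc _ ≤ E * (‖φ p.1‖ * ‖φ p.2‖) * (t * Real.exp t - 2 * Real.exp t + 2 + t) :=
          mul_le_mul_of_nonneg_right hhh hpos
      _ = (‖φ p.1‖ * ‖φ p.2‖) * (E * (t * Real.exp t - 2 * Real.exp t + 2 + t)) := by ring
      _ ≤ (‖φ p.1‖ * ‖φ p.2‖) * (2 * (s * (‖p.1‖ * ‖p.2‖)) + 2) := by gcongr; linarith
      _ = _ := by ring
  · refine Filter.Eventually.of_forall fun p => ?_
    exact (Complex.hasSum_ofReal.2 (hasSum_spectralCoeff _)).mul_left _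

theorem integral_spectral_re_nonneg {h : EuclideanSpace ℝ (Fin N) → ℂ} (hc : Continuous h)
    {φ : EuclideanSpace ℝ (Fin N) → ℂ} (hφ : ∀ k : ℕ, Integrable fun ξ => ‖ξ‖ ^ k * ‖φ ξ‖)
    {s : ℝ} (hs : 0 ≤ s)
    (hle : ∀ ξ, ‖h ξ‖ ≤ Real.exp (-(s * ‖ξ‖ ^ 2 / 2)) * ‖φ ξ‖) :
    0 ≤ (∫ p : EuclideanSpace ℝ (Fin N) × EuclideanSpace ℝ (Fin N),
        h p.1 * conj (h p.2) * ((s * ⟪p.1, p.2⟫) * Real.exp (s * ⟪p.1, p.2⟫)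
          - 2 * Real.exp (s * ⟪p.1, p.2⟫) + 2 + s * ⟪p.1, p.2⟫ : ℝ)).re := by
  have hsum := hasSum_integral_spectralCoeff hc (by simpa using hφ 0) (by simpa using hφ 1) hs hle
  refine (Complex.hasSum_re hsum).nonneg fun k => ?_
  have hh : ∀ k : ℕ, Integrable fun ξ => ‖ξ‖ ^ k * ‖h ξ‖ := fun k => by
    refine (hφ k).mono' (Continuous.aestronglyMeasurable (by fun_prop))
      (Filter.Eventually.of_forall fun ξ => ?_)
    rw [Real.norm_of_nonneg (by positivity)]
    gcongr
    refine (hle ξ).trans (mul_le_of_le_one_left (norm_nonneg _) ?_)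
    rw [Real.exp_le_one_iff]
    have : 0 ≤ s * ‖ξ‖ ^ 2 := by positivity
    linarith
  have := integral_mul_conj_mul_inner_pow_re_nonneg hc.aestronglyMeasurable hh k
  have e : ∀ p : EuclideanSpace ℝ (Fin N) × EuclideanSpace ℝ (Fin N),
      h p.1 * conj (h p.2) * ((spectralCoeff k * (s * ⟪p.1, p.2⟫) ^ k : ℝ) : ℂ)
      = ((spectralCoeff k * s ^ k : ℝ) : ℂ) * (h p.1 * conj (h p.2) * (⟪p.1, p.2⟫ : ℝ) ^ k) := by
    intro p; push_cast; ring
  simp_rw [e]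
  rw [integral_const_mul, Complex.re_ofReal_mul]
  exact mul_nonneg (mul_nonneg (spectralCoeff_nonneg k) (by positivity)) this

section Schwartz

variable {μ : Measure (EuclideanSpace ℝ (Fin N))} [IsFiniteMeasure μ]

theorem SchwartzMap.eq_integral_cexp_inner_mul_fourier (f : 𝓢(EuclideanSpace ℝ (Fin N), ℂ))
    (x : EuclideanSpace ℝ (Fin N)) :
    f x = ∫ ξ, Complex.exp (⟪x, (2 * π) • ξ⟫ * Complex.I) * 𝓕 f ξ := by
  conv_lhs => rw [← FourierTransform.fourierInv_fourier_eq (F := 𝓢(EuclideanSpace ℝ (Fin N), ℂ)) f]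
  rw [SchwartzMap.fourierInv_coe, Real.fourierInv_eq']
  refine integral_congr_ae (Filter.Eventually.of_forall fun ξ => ?_)
  simp only [inner_smul_right, smul_eq_mul, real_inner_comm]

theorem SchwartzMap.integral_eq_integral_charFun_mul_fourier
    (f : 𝓢(EuclideanSpace ℝ (Fin N), ℂ)) :
    ∫ x, f x ∂μ = ∫ ξ, charFun μ ((2 * π) • ξ) * 𝓕 f ξ := by
  simp_rw [f.eq_integral_cexp_inner_mul_fourier]
  exact integral_integral_cexp_inner_mul μ (by fun_prop) (𝓕 f).integrable

theorem SchwartzMap.integrable_fourier_mul_conj_fourier (f : 𝓢(EuclideanSpace ℝ (Fin N), ℂ)) :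
    Integrable fun p : EuclideanSpace ℝ (Fin N) × EuclideanSpace ℝ (Fin N) =>
      𝓕 f p.1 * conj (𝓕 f p.2) :=
  (𝓕 f).integrable.mul_prod (integrable_conj_of_integrable (𝓕 f).integrable)

theorem SchwartzMap.integral_mul_conj_eq (f : 𝓢(EuclideanSpace ℝ (Fin N), ℂ)) :
    ∫ x, f x * conj (f x) ∂μ = ∫ p : EuclideanSpace ℝ (Fin N) × EuclideanSpace ℝ (Fin N),
      charFun μ ((2 * π) • (p.1 - p.2)) * (𝓕 f p.1 * conj (𝓕 f p.2)) := by
  rw [← integral_integral_cexp_inner_mul μ (by fun_prop) f.integrable_fourier_mul_conj_fourier]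
  congr 1
  ext x
  conv_lhs => rw [f.eq_integral_cexp_inner_mul_fourier, ← integral_prod_mul_conj]
  refine integral_congr_ae (Filter.Eventually.of_forall fun p => ?_)
  simp only [map_mul, ← Complex.exp_conj, Complex.conj_ofReal, Complex.conj_I, smul_sub,
    inner_sub_right]
  rw [mul_mul_mul_comm, ← Complex.exp_add]
  congr 2
  push_cast
  ring

/-- The `j`-th partial derivative of a Schwartz function on Euclidean space. -/
noncomputable def SchwartzMap.partialDeriv (f : 𝓢(EuclideanSpace ℝ (Fin N), ℂ)) (j : Fin N) :
    𝓢(EuclideanSpace ℝ (Fin N), ℂ) :=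
  ∂_{EuclideanSpace.single j (1 : ℝ)} f

theorem SchwartzMap.fourier_partialDeriv (f : 𝓢(EuclideanSpace ℝ (Fin N), ℂ)) (j : Fin N)
    (ξ : EuclideanSpace ℝ (Fin N)) :
    𝓕 (f.partialDeriv j) ξ = 2 * π * Complex.I * ((ξ j : ℂ) * 𝓕 f ξ) := by
  have : (inner ℝ · (EuclideanSpace.single j (1 : ℝ)) :
    EuclideanSpace ℝ (Fin N) → ℝ).HasTemperateGrowth := by fun_prop
  rw [SchwartzMap.partialDeriv, SchwartzMap.fourier_lineDerivOp_eq]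
  rw [_root_.smul_apply, SchwartzMap.smulLeftCLM_apply_apply this]
  simp [EuclideanSpace.inner_single_right]

/-- The second order spectral gap of a centred isotropic Gaussian measure,
for Schwartz functions. -/
theorem SchwartzMap.second_order_spectral_gap {lam : ℝ}
    (hμ : ∀ t, charFun μ t = Complex.exp (-(lam ^ 2 * ‖t‖ ^ 2 / 2 : ℝ)))
    (f : 𝓢(EuclideanSpace ℝ (Fin N), ℂ)) :
    0 ≤ ((lam : ℂ) ^ 2 * ∑ j, ∫ x, f.partialDeriv j x *
          conj (f.partialDeriv j x) ∂μ
      - 2 * ∫ x, f x * conj (f x) ∂μ + 2 * ((∫ x, f x ∂μ) * conj (∫ x, f x ∂μ))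
      + (lam : ℂ) ^ 2 * ∑ j, (∫ x, f.partialDeriv j x ∂μ) *
          conj (∫ x, f.partialDeriv j x ∂μ)).re := by
  set s : ℝ := (2 * π * lam) ^ 2 with hs
  set φ := 𝓕 f with hφ
  set G : EuclideanSpace ℝ (Fin N) → ℝ := fun ξ => Real.exp (-(s * ‖ξ‖ ^ 2 / 2)) with hG
  have hG1 : ∀ ξ, ‖(G ξ : ℂ)‖ ≤ 1 := fun ξ => by
    rw [Complex.norm_real, Real.norm_of_nonneg (Real.exp_pos _).le, Real.exp_le_one_iff]
    have : 0 ≤ s * ‖ξ‖ ^ 2 := by positivity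
    linarith
  have hGc : Continuous G := by simp only [hG]; fun_prop
  have hch : ∀ ξ, charFun μ ((2 * π) • ξ) = (G ξ : ℂ) := fun ξ => by
    rw [hμ, norm_smul, Real.norm_of_nonneg (by positivity : 0 ≤ 2 * π), hG]
    push_cast
    congr 1
    rw [hs]
    push_cast
    ring
  have hprodG : ∀ p : EuclideanSpace ℝ (Fin N) × EuclideanSpace ℝ (Fin N),
      G (p.1 - p.2) = G p.1 * G p.2 * Real.exp (s * ⟪p.1, p.2⟫) := fun p => by
    simp only [hG]
    rw [← Real.exp_add, ← Real.exp_add, norm_sub_sq_real]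
    congr 1
    ring
  have hI2 : ∀ g : 𝓢(EuclideanSpace ℝ (Fin N), ℂ),
      Integrable fun p : EuclideanSpace ℝ (Fin N) × EuclideanSpace ℝ (Fin N) =>
        (G (p.1 - p.2) : ℂ) * (𝓕 g p.1 * conj (𝓕 g p.2)) := fun g =>
    g.integrable_fourier_mul_conj_fourier.bdd_mul (c := 1)
      (Continuous.aestronglyMeasurable (by fun_prop)) (Filter.Eventually.of_forall fun _ => hG1 _)
  have hI1 : ∀ g : 𝓢(EuclideanSpace ℝ (Fin N), ℂ),
      Integrable fun p : EuclideanSpace ℝ (Fin N) × EuclideanSpace ℝ (Fin N) =>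
        ((G p.1 : ℂ) * 𝓕 g p.1) * conj ((G p.2 : ℂ) * 𝓕 g p.2) := fun g => by
    have : Integrable fun ξ => (G ξ : ℂ) * 𝓕 g ξ :=
      (𝓕 g).integrable.bdd_mul (c := 1) (Continuous.aestronglyMeasurable (by fun_prop))
        (Filter.Eventually.of_forall hG1)
    exact this.mul_prod (integrable_conj_of_integrable this)
  have hE2 : ∀ g : 𝓢(EuclideanSpace ℝ (Fin N), ℂ), ∫ x, g x * conj (g x) ∂μ
      = ∫ p : EuclideanSpace ℝ (Fin N) × EuclideanSpace ℝ (Fin N),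
        (G (p.1 - p.2) : ℂ) * (𝓕 g p.1 * conj (𝓕 g p.2)) := fun g => by
    simp_rw [g.integral_mul_conj_eq, hch]
  have hE1 : ∀ g : 𝓢(EuclideanSpace ℝ (Fin N), ℂ), (∫ x, g x ∂μ) * conj (∫ x, g x ∂μ)
      = ∫ p : EuclideanSpace ℝ (Fin N) × EuclideanSpace ℝ (Fin N),
        ((G p.1 : ℂ) * 𝓕 g p.1) * conj ((G p.2 : ℂ) * 𝓕 g p.2) := fun g => by
    rw [integral_prod_mul_conj (fun ξ => (G ξ : ℂ) * 𝓕 g ξ),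
      g.integral_eq_integral_charFun_mul_fourier]
    simp_rw [hch]
  have hmain := integral_spectral_re_nonneg (h := fun ξ => (G ξ : ℂ) * φ ξ) (by fun_prop)
    (φ := φ) (fun k => φ.integrable_pow_mul volume k) (s := s) (by positivity)
    (fun ξ => by rw [norm_mul, Complex.norm_real, Real.norm_of_nonneg (Real.exp_pos _).le])
  refine hmain.trans_eq (congrArg Complex.re ?_)
  simp_rw [hE2, hE1]
  rw [← integral_finsetSum _ fun j _ => hI2 _, ← integral_finsetSum _ fun j _ => hI1 _,
    ← integral_const_mul, ← integral_const_mul, ← integral_const_mul, ← integral_const_mul,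
    ← integral_sub, ← integral_add, ← integral_add]
  · refine integral_congr_ae (Filter.Eventually.of_forall fun p => ?_)
    simp only [SchwartzMap.fourier_partialDeriv, ← hφ]
    have hin : ((⟪p.1, p.2⟫ : ℝ) : ℂ) = ∑ j, (p.1 j : ℂ) * (p.2 j : ℂ) := by
      rw [PiLp.inner_apply]; push_cast
      simp [mul_comm]
    have e1 : (lam : ℂ) ^ 2 * ∑ j, (G (p.1 - p.2) : ℂ) * (2 * π * Complex.I * ((p.1 j : ℂ) * φ p.1)
          * conj (2 * π * Complex.I * ((p.2 j : ℂ) * φ p.2)))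
        = s * (⟪p.1, p.2⟫ : ℝ) * (G (p.1 - p.2) * (φ p.1 * conj (φ p.2))) := by
      rw [hin, Finset.mul_sum, Finset.mul_sum, Finset.sum_mul]
      refine Finset.sum_congr rfl fun j _ => ?_
      simp only [map_mul, Complex.conj_ofReal, Complex.conj_I, map_ofNat, hs]
      push_cast
      linear_combination (-(4 : ℂ) * π ^ 2 * lam ^ 2 * (p.1 j : ℂ) * (p.2 j : ℂ) *
        (G (p.1 - p.2) * (φ p.1 * conj (φ p.2)))) * Complex.I_sq
    have e2 : (lam : ℂ) ^ 2 * ∑ j, ((G p.1 : ℂ) * (2 * π * Complex.I * ((p.1 j : ℂ) * φ p.1)))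
          * conj ((G p.2 : ℂ) * (2 * π * Complex.I * ((p.2 j : ℂ) * φ p.2)))
        = s * (⟪p.1, p.2⟫ : ℝ) * (G p.1 * G p.2 * (φ p.1 * conj (φ p.2))) := by
      rw [hin, Finset.mul_sum, Finset.mul_sum, Finset.sum_mul]
      refine Finset.sum_congr rfl fun j _ => ?_
      simp only [map_mul, Complex.conj_ofReal, Complex.conj_I, map_ofNat, hs]
      push_cast
      linear_combination (-(4 : ℂ) * π ^ 2 * lam ^ 2 * (p.1 j : ℂ) * (p.2 j : ℂ) *
        (G p.1 * G p.2 * (φ p.1 * conj (φ p.2)))) * Complex.I_sq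
    rw [e1, e2, hprodG]
    simp only [map_mul, Complex.conj_ofReal]
    push_cast
    ring
  · exact (((integrable_finsetSum _ fun j _ => hI2 _).const_mul _).sub ((hI2 f).const_mul _)).add
      ((hI1 f).const_mul _)
  · exact (integrable_finsetSum _ fun j _ => hI1 _).const_mul _
  · exact ((integrable_finsetSum _ fun j _ => hI2 _).const_mul _).sub ((hI2 f).const_mul _)
  · exact (hI1 f).const_mul _
  · exact (integrable_finsetSum _ fun j _ => hI2 _).const_mul _
  · exact (hI2 f).const_mul _

end Schwartz

end FourierKernel

theorem integral_sub_sq_add_sub_sub_sq {Ω : Type*} [MeasurableSpace Ω] {γ : Measure Ω}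
    [IsProbabilityMeasure γ] {u L : Ω → ℝ} (hu : Integrable u γ)
    (hu2 : Integrable (fun x => u x ^ 2) γ) (huL : Integrable (fun x => u x * L x) γ)
    (hL : Integrable L γ) (hL2 : Integrable (fun x => L x ^ 2) γ) (c : ℝ) :
    ∫ x, ((u x - c) ^ 2 + (u x - c - L x) ^ 2) ∂γ
      = 2 * ∫ x, u x ^ 2 ∂γ + -4 * c * ∫ x, u x ∂γ + 2 * c ^ 2 + -2 * ∫ x, u x * L x ∂γ
        + 2 * c * ∫ x, L x ∂γ + ∫ x, L x ^ 2 ∂γ := by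
  have e : ∀ x, (u x - c) ^ 2 + (u x - c - L x) ^ 2
      = 2 * u x ^ 2 + (-4 * c) * u x + 2 * c ^ 2 + (-2) * (u x * L x) + 2 * c * L x
        + L x ^ 2 := fun x => by ring
  simp_rw [e]
  have i1 := hu2.const_mul 2
  have i2 := i1.fun_add (hu.const_mul (-4 * c))
  have i3 := i2.fun_add (integrable_const (2 * c ^ 2))
  have i4 := i3.fun_add (huL.const_mul (-2))
  have i5 := i4.fun_add (hL.const_mul (2 * c))
  rw [integral_add i5 hL2, integral_add i4 (hL.const_mul (2 * c)),
    integral_add i3 (huL.const_mul (-2)), integral_add i2 (integrable_const (2 * c ^ 2)),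
    integral_add i1 (hu.const_mul (-4 * c))]
  simp only [integral_const_mul, integral_const, probReal_univ, one_smul]

section GaussScaled

variable {N : ℕ} {lam : ℝ}

theorem isGaussian_gaussScaled (hlam : 0 < lam) : IsGaussian (gaussScaled N lam) := by
  rw [gaussScaled_eq_map_stdGaussian N hlam]
  exact inferInstanceAs (IsGaussian ((stdGaussian (EuclideanSpace ℝ (Fin N))).map
    (lam • ContinuousLinearMap.id ℝ (EuclideanSpace ℝ (Fin N)))))

theorem memLp_inner_gaussScaled (hlam : 0 < lam) (D : EuclideanSpace ℝ (Fin N)) :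
    MemLp (fun x => ⟪D, x⟫) 2 (gaussScaled N lam) := by
  have := isGaussian_gaussScaled (N := N) hlam
  exact IsGaussian.memLp_dual (gaussScaled N lam) (innerSL ℝ D) 2 (by simp)

theorem integral_inner_gaussScaled (hlam : 0 < lam) (D : EuclideanSpace ℝ (Fin N)) :
    ∫ x, ⟪D, x⟫ ∂(gaussScaled N lam) = 0 := by
  rw [gaussScaled_eq_map_stdGaussian N hlam, integral_map (by fun_prop)
    (Continuous.aestronglyMeasurable (by fun_prop))]
  simp_rw [inner_smul_right]
  rw [integral_const_mul]
  have := integral_strongDual_stdGaussian (innerSL ℝ D)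
  simp only [innerSL_apply_apply] at this
  rw [this, mul_zero]

theorem integral_inner_sq_gaussScaled (hlam : 0 < lam) (D : EuclideanSpace ℝ (Fin N)) :
    ∫ x, ⟪D, x⟫ ^ 2 ∂(gaussScaled N lam) = lam ^ 2 * ‖D‖ ^ 2 := by
  rw [gaussScaled_eq_map_stdGaussian N hlam, integral_map (by fun_prop)
    (Continuous.aestronglyMeasurable (by fun_prop))]
  simp_rw [inner_smul_right, mul_pow]
  rw [integral_const_mul]
  have h := variance_dual_stdGaussian (innerSL ℝ D)
  rw [variance_of_integral_eq_zero (by fun_prop) (integral_strongDual_stdGaussian _),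
    innerSL_apply_norm] at h
  simp only [innerSL_apply_apply] at h
  rw [h]

theorem exists_integral_gaussScaled_eq (N : ℕ) (lam : ℝ) :
    ∃ c : ℝ, ∀ g : EuclideanSpace ℝ (Fin N) → ℝ,
      ∫ x, g x ∂(gaussScaled N lam) = c * ∫ x, g x * Real.exp (-‖x‖ ^ 2 / (2 * lam ^ 2)) := by
  refine ⟨((volume.withDensity fun x : EuclideanSpace ℝ (Fin N) =>
    ENNReal.ofReal (Real.exp (-‖x‖ ^ 2 / (2 * lam ^ 2)))) Set.univ)⁻¹.toReal, fun g => ?_⟩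
  rw [gaussScaled, integral_smul_measure,
    integral_withDensity_eq_integral_toReal_smul (by fun_prop) (by simp), smul_eq_mul]
  congr 1
  refine integral_congr_ae (Filter.Eventually.of_forall fun x => ?_)
  simp only [ENNReal.toReal_ofReal (Real.exp_pos _).le, smul_eq_mul, mul_comm]

/-- Gaussian integration by parts. -/
theorem integral_mul_inner_gaussScaled (hlam : 0 < lam) {u : EuclideanSpace ℝ (Fin N) → ℝ}
    (hu : ContDiff ℝ 1 u) (hsupp : HasCompactSupport u) (D : EuclideanSpace ℝ (Fin N)) :
    ∫ x, u x * ⟪D, x⟫ ∂(gaussScaled N lam) =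
      lam ^ 2 * ∫ x, fderiv ℝ u x D ∂(gaussScaled N lam) := by
  obtain ⟨c, hc⟩ := exists_integral_gaussScaled_eq N lam
  set ρ : EuclideanSpace ℝ (Fin N) → ℝ := fun x => Real.exp (-‖x‖ ^ 2 / (2 * lam ^ 2)) with hρ
  have hρc : Continuous ρ := by simp only [hρ]; fun_prop
  have hρd : ∀ x, HasFDerivAt ρ (ρ x • (2 * lam ^ 2)⁻¹ •
      -(2 • innerSL ℝ x : EuclideanSpace ℝ (Fin N) →L[ℝ] ℝ)) x := fun x => by
    have hρe : ρ = fun x => Real.exp ((2 * lam ^ 2)⁻¹ * -‖x‖ ^ 2) := by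
      funext y; simp only [hρ, div_eq_inv_mul]
    rw [hρe]
    exact (((hasStrictFDerivAt_norm_sq x).hasFDerivAt.neg).const_mul ((2 * lam ^ 2)⁻¹)).exp
  have hρD : ∀ x, fderiv ℝ ρ x D = -(lam ^ 2)⁻¹ * (⟪D, x⟫ * ρ x) := fun x => by
    rw [(hρd x).fderiv]
    simp only [smul_apply, neg_apply, innerSL_apply_apply,
      smul_eq_mul, nsmul_eq_mul, real_inner_comm D x]
    push_cast
    field_simp
  have huD : Continuous fun x => fderiv ℝ u x D :=
    (hu.continuous_fderiv one_ne_zero).clm_apply continuous_const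
  have hibp := integral_mul_fderiv_eq_neg_fderiv_mul_of_integrable (μ := volume) (f := u) (g := ρ)
    (v := D) ?_ ?_ ?_ (fun x _ => hu.differentiable one_ne_zero x)
    (fun x _ => (hρd x).differentiableAt)
  · rw [hc, hc]
    simp_rw [hρD] at hibp
    have e : ∀ x, u x * (-(lam ^ 2)⁻¹ * (⟪D, x⟫ * ρ x))
        = -(lam ^ 2)⁻¹ * (u x * ⟪D, x⟫ * ρ x) := fun x => by ring
    simp_rw [e] at hibp
    rw [integral_const_mul] at hibp
    have hl : lam ^ 2 ≠ 0 := by positivity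
    field_simp at hibp
    rw [neg_inj] at hibp
    rw [hibp]
    ring
  · exact (huD.mul hρc).integrable_of_hasCompactSupport ((hsupp.fderiv_apply ℝ D).mul_right)
  · simp_rw [hρD]
    exact Continuous.integrable_of_hasCompactSupport
      (hu.continuous.mul (by fun_prop)) hsupp.mul_right
  · exact (hu.continuous.mul hρc).integrable_of_hasCompactSupport hsupp.mul_right

/-- The second order spectral gap of the scaled Gaussian measure, for test functions. -/
theorem two_mul_variance_le_gaussScaled (hlam : 0 < lam) {u : EuclideanSpace ℝ (Fin N) → ℝ}
    (hu : ContDiff ℝ (⊤ : ℕ∞) u) (hsupp : HasCompactSupport u) :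
    2 * ∫ x, u x ^ 2 ∂(gaussScaled N lam) - 2 * (∫ x, u x ∂(gaussScaled N lam)) ^ 2
      - lam ^ 2 * ∑ j, (∫ x, gradient u x j ∂(gaussScaled N lam)) ^ 2
      ≤ lam ^ 2 * ∑ j, ∫ x, gradient u x j ^ 2 ∂(gaussScaled N lam) := by
  have := (isProbabilityMeasure_and_charFun_gaussScaled N hlam).1
  have hud : Differentiable ℝ u := hu.differentiable (by simp)
  set f : 𝓢(EuclideanSpace ℝ (Fin N), ℂ) :=
    (hsupp.comp_left Complex.ofReal_zero).toSchwartzMap (Complex.ofRealCLM.contDiff.comp hu) with hf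
  have hfu : ∀ x, f x = (u x : ℂ) := fun x => rfl
  have hfd : ∀ j x, f.partialDeriv j x = (gradient u x j : ℂ) := fun j x => by
    have hg : gradient u x j = fderiv ℝ u x (EuclideanSpace.single j 1) := by
      rw [← inner_gradient_left, EuclideanSpace.inner_single_right]
      simp
    rw [SchwartzMap.partialDeriv, SchwartzMap.lineDerivOp_apply_eq_fderiv, hg]
    have : HasFDerivAt f (Complex.ofRealCLM.comp (fderiv ℝ u x)) x :=
      Complex.ofRealCLM.hasFDerivAt.comp x (hud x).hasFDerivAt
    rw [this.fderiv]
    rfl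
  have h := f.second_order_spectral_gap (isProbabilityMeasure_and_charFun_gaussScaled N hlam).2
  simp_rw [hfu, hfd, Complex.conj_ofReal, ← Complex.ofReal_mul, integral_complex_ofReal,
    Complex.conj_ofReal] at h
  norm_cast at h
  simp_rw [pow_two] at h ⊢
  linarith

theorem continuous_gradient {u : EuclideanSpace ℝ (Fin N) → ℝ} (hu : ContDiff ℝ 1 u) :
    Continuous (gradient u) :=
  (InnerProductSpace.toDual ℝ _).symm.continuous.comp (hu.continuous_fderiv one_ne_zero)

theorem hasCompactSupport_gradient {u : EuclideanSpace ℝ (Fin N) → ℝ}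
    (hsupp : HasCompactSupport u) :
    HasCompactSupport (gradient u) :=
  (hsupp.fderiv ℝ).comp_left (map_zero (InnerProductSpace.toDual ℝ _).symm)

theorem integral_norm_gradient_sq (γ : Measure (EuclideanSpace ℝ (Fin N))) [IsFiniteMeasure γ]
    {u : EuclideanSpace ℝ (Fin N) → ℝ} (hu : ContDiff ℝ 1 u) (hsupp : HasCompactSupport u) :
    ∫ x, ‖gradient u x‖ ^ 2 ∂γ = ∑ j, ∫ x, gradient u x j ^ 2 ∂γ := by
  have hgc := continuous_gradient hu
  simp_rw [EuclideanSpace.real_norm_sq_eq]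
  refine integral_finsetSum _ fun j _ => ?_
  refine Continuous.integrable_of_hasCompactSupport (by fun_prop) ?_
  exact (hasCompactSupport_gradient hsupp).comp_left
    (g := fun y : EuclideanSpace ℝ (Fin N) => y j ^ 2) (by simp)

/-- The value of the double least-squares functional at the mean and the mean gradient. -/
theorem integral_sub_sq_add_sub_sub_inner_sq_gaussScaled (hlam : 0 < lam)
    {u : EuclideanSpace ℝ (Fin N) → ℝ} (hu : ContDiff ℝ 1 u) (hsupp : HasCompactSupport u)
    {c : ℝ} (hc : ∫ x, u x ∂(gaussScaled N lam) = c) {D : EuclideanSpace ℝ (Fin N)}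
    (hD : ∫ x, gradient u x ∂(gaussScaled N lam) = D) :
    ∫ x, ((u x - c) ^ 2 + (u x - c - ⟪D, x⟫) ^ 2) ∂(gaussScaled N lam)
      = 2 * ∫ x, u x ^ 2 ∂(gaussScaled N lam) - 2 * c ^ 2 - lam ^ 2 * ‖D‖ ^ 2 := by
  have := (isProbabilityMeasure_and_charFun_gaussScaled N hlam).1
  have hgi : Integrable (gradient u) (gaussScaled N lam) :=
    (continuous_gradient hu).integrable_of_hasCompactSupport (hasCompactSupport_gradient hsupp)
  have hui : Integrable u (gaussScaled N lam) :=
    hu.continuous.integrable_of_hasCompactSupport hsupp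
  have hu2 : Integrable (fun x => u x ^ 2) (gaussScaled N lam) := by
    simp_rw [pow_two]
    exact (hu.continuous.mul hu.continuous).integrable_of_hasCompactSupport hsupp.mul_right
  have huD : Integrable (fun x => u x * ⟪D, x⟫) (gaussScaled N lam) :=
    (hu.continuous.mul (by fun_prop)).integrable_of_hasCompactSupport hsupp.mul_right
  have hD2 := memLp_inner_gaussScaled hlam D
  have hcross : ∫ x, u x * ⟪D, x⟫ ∂(gaussScaled N lam) = lam ^ 2 * ‖D‖ ^ 2 := by
    rw [integral_mul_inner_gaussScaled hlam hu hsupp]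
    simp_rw [← inner_gradient_left, real_inner_comm D]
    rw [integral_inner hgi, hD, real_inner_self_eq_norm_sq]
  rw [integral_sub_sq_add_sub_sub_sq hui hu2 huD (hD2.integrable (by norm_num))
    hD2.integrable_sq c, hcross, integral_inner_gaussScaled hlam,
    integral_inner_sq_gaussScaled hlam, hc]
  ring

end GaussScaled

/-- Improved scale-dependent Gaussian Poincaré inequality:
`∫|∇u|² dμ_λ ≥ (1/λ²) inf_{c,d} ∫ (|u − c|² + |u − c − d·x|²) dμ_λ`. -/
theorem improved_scale_poincare_gaussian {N : ℕ} (lam : ℝ) (hlam : 0 < lam)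
    (u : EuclideanSpace ℝ (Fin N) → ℝ) (hu : ContDiff ℝ (⊤ : ℕ∞) u) (hsupp : HasCompactSupport u) :
    ∫ x, ‖gradient u x‖ ^ 2 ∂(gaussScaled N lam) ≥
      (1 / lam ^ 2) * ⨅ (c : ℝ) (d : Fin N → ℝ),
        ∫ x, ((u x - c) ^ 2 + (u x - c - ∑ j, d j * x j) ^ 2) ∂(gaussScaled N lam) := by
  have hgap := two_mul_variance_le_gaussScaled hlam hu hsupp
  have := (isProbabilityMeasure_and_charFun_gaussScaled N hlam).1
  have hu1 : ContDiff ℝ 1 u := hu.of_le (by exact_mod_cast le_top)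
  obtain ⟨c, hc⟩ : ∃ c, ∫ x, u x ∂(gaussScaled N lam) = c := ⟨_, rfl⟩
  obtain ⟨D, hD⟩ : ∃ D, ∫ x, gradient u x ∂(gaussScaled N lam) = D := ⟨_, rfl⟩
  have hDj : ∀ j, ∫ x, gradient u x j ∂(gaussScaled N lam) = D j := fun j => by
    rw [← hD]
    exact (EuclideanSpace.proj (𝕜 := ℝ) j).integral_comp_comm
      ((continuous_gradient hu1).integrable_of_hasCompactSupport (hasCompactSupport_gradient hsupp))
  have hval := integral_sub_sq_add_sub_sub_inner_sq_gaussScaled hlam hu1 hsupp hc hD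
  have hDx : ∀ x, ⟪D, x⟫ = ∑ j, D j * x j := fun x => by
    rw [PiLp.inner_apply]; simp [mul_comm]
  simp_rw [hDx] at hval
  simp_rw [hDj, ← EuclideanSpace.real_norm_sq_eq, hc] at hgap
  have hinf : ⨅ (c : ℝ) (d : Fin N → ℝ),
      ∫ x, ((u x - c) ^ 2 + (u x - c - ∑ j, d j * x j) ^ 2) ∂(gaussScaled N lam)
      ≤ ∫ x, ((u x - c) ^ 2 + (u x - c - ∑ j, D j * x j) ^ 2) ∂(gaussScaled N lam) := by
    have hnn : ∀ (c : ℝ) (d : Fin N → ℝ),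
        0 ≤ ∫ x, ((u x - c) ^ 2 + (u x - c - ∑ j, d j * x j) ^ 2) ∂(gaussScaled N lam) :=
      fun c d => integral_nonneg fun x => by positivity
    refine (ciInf_le ⟨0, ?_⟩ c).trans (ciInf_le ⟨0, ?_⟩ (fun j => D j))
    · rintro _ ⟨c', rfl⟩
      exact Real.iInf_nonneg fun d => hnn c' d
    · rintro _ ⟨d, rfl⟩
      exact hnn c d
  rw [ge_iff_le, integral_norm_gradient_sq _ hu1 hsupp, one_div, inv_mul_le_iff₀ (by positivity)]
  linarith [hinf.trans_eq hval]
end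

section
/- Let λ > 0 and let u_λ(x) = a₁(x₁² − λ²) + ⋯ + a_N(x_N² − λ²) with real coefficients a₁,…,a_N not all zero. Then u_λ is a non-linear function attaining equality in the improved scale-dependent Gaussian Poincaré inequality: ∫_{ℝ^N} |∇u_λ|² dμ_λ = (1/λ²) inf over c ∈ ℝ and d ∈ ℝ^N of ∫_{ℝ^N} ( |u_λ − c|² + |u_λ − c − d·x|² ) dμ_λ. -/
open MeasureTheory Real

open ProbabilityTheory

/-- A finite product of nondegenerate real Gaussian measures has the product density. -/
lemma pi_gaussianReal_eq_withDensity {ι : Type*} [Fintype ι] {v : NNReal} (hv : v ≠ 0) :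
    Measure.pi (fun _ : ι => gaussianReal 0 v) =
      (volume : Measure (ι → ℝ)).withDensity
        (fun x => ENNReal.ofReal (∏ i, gaussianPDFReal 0 v (x i))) := by
  refine Measure.pi_eq fun s hs => ?_
  have hint : Integrable (fun x : ι → ℝ => ∏ i, gaussianPDFReal 0 v (x i)) :=
    Integrable.fintype_prod fun _ => integrable_gaussianPDFReal 0 v
  rw [withDensity_apply _ (MeasurableSet.univ_pi hs),
    ← ofReal_integral_eq_lintegral_ofReal hint.integrableOn
      (ae_of_all _ fun x => Finset.prod_nonneg fun i _ => gaussianPDFReal_nonneg 0 v (x i)),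
    ← integral_indicator (MeasurableSet.univ_pi hs)]
  have hind : (Set.univ.pi s).indicator (fun x : ι → ℝ => ∏ i, gaussianPDFReal 0 v (x i)) =
      fun x => ∏ i, (s i).indicator (gaussianPDFReal 0 v) (x i) := by
    funext x
    by_cases hx : x ∈ Set.univ.pi s
    · rw [Set.indicator_of_mem hx]
      exact Finset.prod_congr rfl fun i _ =>
        (Set.indicator_of_mem (hx i (Set.mem_univ i)) _).symm
    · rw [Set.indicator_of_notMem hx]
      simp only [Set.mem_pi, Set.mem_univ, forall_const, not_forall] at hx
      obtain ⟨i, hi⟩ := hx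
      exact (Finset.prod_eq_zero (Finset.mem_univ i) (Set.indicator_of_notMem hi _)).symm
  rw [hind, integral_fintype_prod_volume_eq_prod
    (fun i => (s i).indicator (gaussianPDFReal 0 v)), ENNReal.ofReal_prod_of_nonneg]
  · refine Finset.prod_congr rfl fun i _ => ?_
    rw [integral_indicator (hs i), gaussianReal_apply_eq_integral 0 hv]
  · intro i _
    exact integral_nonneg fun x =>
      Set.indicator_nonneg (fun y _ => gaussianPDFReal_nonneg 0 v y) x

/-- The normalized Gaussian measure on Euclidean space is a product of real Gaussians. -/
lemma gaussScaled_eq_map_pi (N : ℕ) {lam : ℝ} (hlam : 0 < lam) :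
    gaussScaled N lam =
      (Measure.pi fun _ : Fin N => gaussianReal 0 (lam ^ 2).toNNReal).map (WithLp.toLp 2) := by
  set v : NNReal := (lam ^ 2).toNNReal with hv_def
  have hvc : (v : ℝ) = lam ^ 2 := Real.coe_toNNReal _ (by positivity)
  have hv : v ≠ 0 := by
    intro h
    rw [h] at hvc
    exact (pow_pos hlam 2).ne hvc
  set M : Measure (EuclideanSpace ℝ (Fin N)) := volume.withDensity
    (fun x => ENNReal.ofReal (Real.exp (-‖x‖ ^ 2 / (2 * lam ^ 2)))) with hM
  set C : ℝ := (√(2 * π * v))⁻¹ ^ N with hC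
  have hCpos : 0 < C := by
    rw [hC, hvc]
    positivity
  have hdens : ∀ x : Fin N → ℝ, ∏ i, gaussianPDFReal 0 v (x i) =
      C * Real.exp (-‖WithLp.toLp 2 x‖ ^ 2 / (2 * lam ^ 2)) := by
    intro x
    simp only [gaussianPDFReal, Finset.prod_mul_distrib, Finset.prod_const, Finset.card_univ,
      Fintype.card_fin, ← Real.exp_sum, sub_zero, hvc, hC]
    rw [EuclideanSpace.norm_sq_eq, ← Finset.sum_div, ← Finset.sum_neg_distrib]
    simp
  have hmap : (Measure.pi fun _ : Fin N => gaussianReal 0 v).map (WithLp.toLp 2) =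
      ENNReal.ofReal C • M := by
    rw [pi_gaussianReal_eq_withDensity hv]
    ext s hs
    have hmeas : Measurable fun x : EuclideanSpace ℝ (Fin N) =>
        ENNReal.ofReal (Real.exp (-‖x‖ ^ 2 / (2 * lam ^ 2))) := by fun_prop
    have hto : Measurable (WithLp.toLp 2 : (Fin N → ℝ) → EuclideanSpace ℝ (Fin N)) :=
      (PiLp.volume_preserving_toLp (Fin N)).measurable
    rw [Measure.map_apply hto hs, withDensity_apply _ (hto hs), Measure.smul_apply, hM,
      withDensity_apply _ hs, smul_eq_mul,
      ← (PiLp.volume_preserving_toLp (Fin N)).setLIntegral_comp_preimage hs hmeas,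
      ← lintegral_const_mul' _ _ ENNReal.ofReal_ne_top]
    refine lintegral_congr fun x => ?_
    rw [hdens, ENNReal.ofReal_mul hCpos.le]
  have hone : ENNReal.ofReal C * M Set.univ = 1 := by
    have : IsProbabilityMeasure
        ((Measure.pi fun _ : Fin N => gaussianReal 0 v).map (WithLp.toLp 2)) :=
      Measure.isProbabilityMeasure_map
        (PiLp.volume_preserving_toLp (Fin N)).measurable.aemeasurable
    have h := this.measure_univ
    rwa [hmap, Measure.smul_apply, smul_eq_mul] at h
  rw [hmap, ENNReal.eq_inv_of_mul_eq_one_left hone]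
  rfl

/-- The fourth moment of a centered real Gaussian measure. -/
lemma integral_pow_four_gaussianReal (v : NNReal) :
    ∫ x, x ^ 4 ∂gaussianReal 0 v = 3 * (v : ℝ) ^ 2 := by
  have h : ∫ x, x ^ 4 ∂gaussianReal 0 v =
      iteratedDeriv 4 (mgf (fun x ↦ x) (gaussianReal 0 v)) 0 := by
    rw [iteratedDeriv_mgf_zero] <;> simp
  have key : ∀ p q : ℝ → ℝ, (∀ t, HasDerivAt p (q t) t) →
      deriv (fun t => p t * rexp (v * t ^ 2 / 2)) =
        fun t => (q t + p t * (v * t)) * rexp (v * t ^ 2 / 2) := by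
    intro p q hp
    funext t
    have he : HasDerivAt (fun t : ℝ => rexp (v * t ^ 2 / 2))
        (rexp (v * t ^ 2 / 2) * (v * t)) t := by
      refine HasDerivAt.exp ?_
      have := (((hasDerivAt_id t).pow 2).const_mul (v : ℝ)).div_const 2
      refine this.congr_deriv ?_
      simp
      ring
    refine ((hp t).mul he).deriv.trans ?_
    ring
  have h0 : mgf (fun x ↦ x) (gaussianReal 0 v) = fun t => 1 * rexp (v * t ^ 2 / 2) := by
    rw [mgf_fun_id_gaussianReal]
    simp
  rw [h, h0]
  simp only [iteratedDeriv_succ, iteratedDeriv_zero]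
  rw [key (fun _ => 1) (fun _ => 0) (fun t => hasDerivAt_const t 1),
    key (fun t => 0 + 1 * (v * t)) (fun _ => v) (fun t => by
      simpa using (hasDerivAt_id t).const_mul (v : ℝ)),
    key (fun t => v + (0 + 1 * (v * t)) * (v * t)) (fun t => 2 * v ^ 2 * t) (fun t => by
      have h2 := (((hasDerivAt_id t).pow 2).const_mul ((v : ℝ) ^ 2)).const_add (v : ℝ)
      refine (h2.congr_deriv ?_).congr_of_eventuallyEq (.of_forall fun s => ?_)
      all_goals simp
      all_goals ring),
    key (fun t => 2 * v ^ 2 * t + (v + (0 + 1 * (v * t)) * (v * t)) * (v * t))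
      (fun t => 3 * v ^ 2 + 3 * v ^ 3 * t ^ 2) (fun t => by
      have h3 := ((hasDerivAt_id t).const_mul (3 * (v : ℝ) ^ 2)).add
        (((hasDerivAt_id t).pow 3).const_mul ((v : ℝ) ^ 3))
      refine (h3.congr_deriv ?_).congr_of_eventuallyEq (.of_forall fun s => ?_)
      all_goals simp
      all_goals ring)]
  simp

/-- The second moment of a centered real Gaussian measure. -/
lemma integral_sq_gaussianReal (v : NNReal) : ∫ x, x ^ 2 ∂gaussianReal 0 v = v := by
  have h := variance_fun_id_gaussianReal (μ := 0) (v := v)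
  rw [variance_eq_integral measurable_id'.aemeasurable] at h
  simpa using h

/-- The square of the identity is square integrable for a real Gaussian measure. -/
lemma memLp_sq_gaussianReal (v : NNReal) :
    MemLp (fun x : ℝ => x ^ 2) 2 (gaussianReal 0 v) := by
  rw [memLp_two_iff_integrable_sq (by fun_prop)]
  have h := (memLp_id_gaussianReal (μ := 0) (v := v) 4).integrable_norm_pow (by norm_num)
  refine h.congr (ae_of_all _ fun x => ?_)
  simp only [id, Real.norm_eq_abs, ← pow_mul]
  exact Even.pow_abs (by decide) x

/-- The second Hermite-type polynomials `a (x² - v)` have mean zero. -/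
lemma integral_const_mul_sq_sub_gaussianReal (a : ℝ) (v : NNReal) :
    ∫ x, a * (x ^ 2 - v) ∂gaussianReal 0 v = 0 := by
  rw [integral_const_mul, integral_sub ((memLp_sq_gaussianReal v).integrable (by norm_num))
    (integrable_const _), integral_sq_gaussianReal]
  simp

lemma memLp_const_mul_sq_sub_gaussianReal (a : ℝ) (v : NNReal) :
    MemLp (fun x : ℝ => a * (x ^ 2 - v)) 2 (gaussianReal 0 v) :=
  ((memLp_sq_gaussianReal v).sub (memLp_const _)).const_mul a

lemma variance_const_mul_sq_sub_gaussianReal (a : ℝ) (v : NNReal) :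
    Var[fun x => a * (x ^ 2 - v); gaussianReal 0 v] = 2 * a ^ 2 * (v : ℝ) ^ 2 := by
  have hsq := (memLp_sq_gaussianReal v)
  rw [variance_const_mul, variance_sub_const (by fun_prop), variance_eq_sub hsq]
  have : ((fun x : ℝ => x ^ 2) ^ 2) = fun x : ℝ => x ^ 4 := by
    funext x
    simp only [Pi.pow_apply]
    ring
  rw [this, integral_pow_four_gaussianReal, integral_sq_gaussianReal]
  ring

/-- The gradient of a diagonal quadratic polynomial on Euclidean space. -/
lemma hasGradientAt_sum_mul_sq_sub {ι : Type*} [Fintype ι] (a : ι → ℝ) (b : ℝ)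
    (x : EuclideanSpace ℝ ι) :
    HasGradientAt (fun x : EuclideanSpace ℝ ι => ∑ i, a i * ((x i) ^ 2 - b))
      (WithLp.toLp 2 fun i => 2 * a i * x i) x := by
  rw [hasGradientAt_iff_hasFDerivAt]
  have h : HasFDerivAt (fun x : EuclideanSpace ℝ ι => ∑ i, a i * ((x i) ^ 2 - b))
      (∑ i, a i • ((2 * x i) • (EuclideanSpace.proj i : EuclideanSpace ℝ ι →L[ℝ] ℝ))) x := by
    refine HasFDerivAt.fun_sum fun i _ => HasFDerivAt.const_mul ?_ (a i)
    have hp : HasFDerivAt (fun x : EuclideanSpace ℝ ι => x i)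
        (EuclideanSpace.proj i : EuclideanSpace ℝ ι →L[ℝ] ℝ) x :=
      (EuclideanSpace.proj i : EuclideanSpace ℝ ι →L[ℝ] ℝ).hasFDerivAt
    simpa using (hp.pow 2).sub_const b
  refine h.congr_fderiv (ContinuousLinearMap.ext fun y => ?_)
  simp only [InnerProductSpace.toDual_apply_apply, PiLp.inner_apply, sum_apply,
    smul_apply, PiLp.proj_apply, smul_eq_mul, RCLike.inner_apply, conj_trivial]
  exact Finset.sum_congr rfl fun i _ => by ring

/-- If `∫ f = 0` and `f` is orthogonal to `g` in `L²` of a probability measure, then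
subtracting a constant and a multiple of `g` does not decrease the total squared error. -/
lemma integral_two_mul_sq_le {Ω : Type*} [MeasurableSpace Ω] {μ : Measure Ω}
    [IsProbabilityMeasure μ] {f g : Ω → ℝ} (hf : MemLp f 2 μ) (hg : MemLp g 2 μ)
    (hf0 : ∫ x, f x ∂μ = 0) (hfg : ∫ x, f x * g x ∂μ = 0) (c : ℝ) :
    ∫ x, 2 * f x ^ 2 ∂μ ≤ ∫ x, ((f x - c) ^ 2 + (f x - c - g x) ^ 2) ∂μ := by
  have h1 : Integrable (fun x => 2 * f x ^ 2) μ := hf.integrable_sq.const_mul 2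
  have h2 : Integrable (fun x => 4 * c * f x) μ := (hf.integrable (by norm_num)).const_mul _
  have h12 : Integrable (fun x => 2 * f x ^ 2 - 4 * c * f x) μ := h1.sub h2
  have h3 : Integrable (fun x => 2 * (f x * g x)) μ := (hf.integrable_mul hg).const_mul 2
  have hfc : MemLp (fun x => f x - c) 2 μ := hf.sub (memLp_const c)
  have h4 : Integrable (fun x => (f x - c) ^ 2 + (f x - c - g x) ^ 2) μ :=
    hfc.integrable_sq.add (hfc.sub hg).integrable_sq
  calc ∫ x, 2 * f x ^ 2 ∂μ
      = ∫ x, (2 * f x ^ 2 - 4 * c * f x - 2 * (f x * g x)) ∂μ := by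
        rw [integral_sub h12 h3, integral_sub h1 h2, integral_const_mul (4 * c),
          integral_const_mul 2 (fun x => f x * g x), hf0, hfg]
        simp
    _ ≤ _ := by
        refine integral_mono (h12.sub h3) h4 fun x => ?_
        simp only
        nlinarith [sq_nonneg c, sq_nonneg (c + g x)]

/-- The non-linear functions `u_λ(x) = Σ_i a_i (x_i² − λ²)` (with `a ≠ 0`) attain equality
in the improved scale-dependent Gaussian Poincaré inequality. -/
theorem improved_scale_poincare_gaussian_attained {N : ℕ} (lam : ℝ) (hlam : 0 < lam)
    (a : Fin N → ℝ) (ha : a ≠ 0) :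
    let u : EuclideanSpace ℝ (Fin N) → ℝ := fun x => ∑ i, a i * ((x i) ^ 2 - lam ^ 2)
    (¬ ∃ (c : ℝ) (d : Fin N → ℝ), ∀ x : EuclideanSpace ℝ (Fin N),
        u x = c + ∑ j, d j * x j) ∧
    ∫ x, ‖gradient u x‖ ^ 2 ∂(gaussScaled N lam) =
      (1 / lam ^ 2) * ⨅ (c : ℝ) (d : Fin N → ℝ),
        ∫ x, ((u x - c) ^ 2 + (u x - c - ∑ j, d j * x j) ^ 2) ∂(gaussScaled N lam) := by
  intro u
  refine ⟨?_, ?_⟩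
  · rintro ⟨c, d, h⟩
    obtain ⟨i, hi⟩ := Function.ne_iff.mp ha
    have hp := h (EuclideanSpace.single i 1)
    have hn := h (EuclideanSpace.single i (-1))
    have hz := h 0
    simp only [u, PiLp.single_apply, PiLp.zero_apply, mul_sub, Finset.sum_sub_distrib, ite_pow,
      mul_ite] at hp hn hz
    simp at hp hn hz
    exact hi (by simp; linarith)
  set v : NNReal := (lam ^ 2).toNNReal with hv_def
  have hvc : (v : ℝ) = lam ^ 2 := Real.coe_toNNReal _ (by positivity)
  set ν : Measure (Fin N → ℝ) := Measure.pi fun _ : Fin N => gaussianReal 0 v with hν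
  have hto : Measurable (WithLp.toLp 2 : (Fin N → ℝ) → EuclideanSpace ℝ (Fin N)) :=
    (PiLp.volume_preserving_toLp (Fin N)).measurable
  have hchange : ∀ F : EuclideanSpace ℝ (Fin N) → ℝ, Continuous F →
      ∫ x, F x ∂(gaussScaled N lam) = ∫ y, F (WithLp.toLp 2 y) ∂ν := by
    intro F hF
    rw [gaussScaled_eq_map_pi N hlam, integral_map hto.aemeasurable hF.aestronglyMeasurable]
  set w : (Fin N → ℝ) → ℝ := fun y => ∑ i, a i * ((y i) ^ 2 - v) with hw
  have hwu : ∀ y, u (WithLp.toLp 2 y) = w y := fun y => by simp only [u, hw, hvc]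
  have hucont : Continuous u := by fun_prop
  have hcoord : ∀ i, MemLp (fun y : Fin N → ℝ => a i * ((y i) ^ 2 - v)) 2 ν := fun i =>
    (memLp_const_mul_sq_sub_gaussianReal (a i) v).comp_measurePreserving
      (measurePreserving_eval (fun _ : Fin N => gaussianReal 0 v) i)
  have hwL : MemLp w 2 ν := memLp_finsetSum _ fun i _ => hcoord i
  have hw0 : ∫ y, w y ∂ν = 0 := by
    rw [hw, integral_finsetSum _ fun i _ => (hcoord i).integrable (by norm_num)]
    refine Finset.sum_eq_zero fun i _ => ?_
    rw [hν, integral_comp_eval (μ := fun _ : Fin N => gaussianReal 0 v) (i := i)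
      (f := fun t => a i * (t ^ 2 - v)) (by fun_prop)]
    exact integral_const_mul_sq_sub_gaussianReal _ _
  have hw2 : ∫ y, w y ^ 2 ∂ν = ∑ i, 2 * a i ^ 2 * (v : ℝ) ^ 2 := by
    have h := variance_sum_pi (μ := fun _ : Fin N => gaussianReal 0 v)
      (X := fun i t => a i * (t ^ 2 - v)) fun i => memLp_const_mul_sq_sub_gaussianReal (a i) v
    have hsum : (∑ i, fun y : Fin N → ℝ => a i * ((y i) ^ 2 - v)) = w := by
      funext y
      simp [hw]
    rw [hsum, variance_of_integral_eq_zero hwL.aestronglyMeasurable.aemeasurable hw0] at h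
    rw [h]
    exact Finset.sum_congr rfl fun i _ => variance_const_mul_sq_sub_gaussianReal _ _
  have hidL : ∀ i, MemLp (fun y : Fin N → ℝ => y i) 2 ν := fun i =>
    (memLp_id_gaussianReal' (μ := 0) (v := v) 2 (by norm_num)).comp_measurePreserving
      (measurePreserving_eval (fun _ : Fin N => gaussianReal 0 v) i)
  have hlinL : ∀ d : Fin N → ℝ, MemLp (fun y => ∑ j, d j * y j) 2 ν := fun d =>
    memLp_finsetSum _ fun j _ => (hidL j).const_mul (d j)
  have hneg : MeasurePreserving (fun y : Fin N → ℝ => fun i => -y i) ν ν :=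
    measurePreserving_pi _ _ fun i => ⟨measurable_neg, by simp [gaussianReal_map_neg]⟩
  have horth : ∀ d : Fin N → ℝ, ∫ y, w y * ∑ j, d j * y j ∂ν = 0 := by
    intro d
    have h1 : ∫ y, w y * ∑ j, d j * y j ∂ν =
        ∫ y, w (fun i => -y i) * ∑ j, d j * (-y j) ∂ν := by
      conv_lhs => rw [← hneg.map_eq]
      rw [integral_map hneg.measurable.aemeasurable]
      exact Continuous.aestronglyMeasurable (by fun_prop)
    have h2 : ∀ y : Fin N → ℝ, w (fun i => -y i) * ∑ j, d j * (-y j) =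
        -(w y * ∑ j, d j * y j) := fun y => by
      simp [hw, Finset.sum_neg_distrib]
    simp only [h2, integral_neg] at h1
    linarith
  have hgrad : ∫ x, ‖gradient u x‖ ^ 2 ∂(gaussScaled N lam) = ∑ i, 4 * a i ^ 2 * (v : ℝ) := by
    have hg : ∀ x, ‖gradient u x‖ ^ 2 = ∑ i, 4 * a i ^ 2 * (x i) ^ 2 := fun x => by
      rw [(hasGradientAt_sum_mul_sq_sub a (lam ^ 2) x).gradient, EuclideanSpace.norm_sq_eq]
      refine Finset.sum_congr rfl fun i _ => ?_
      rw [Real.norm_eq_abs, sq_abs]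
      ring
    simp only [hg]
    rw [hchange _ (by fun_prop), integral_finsetSum _ fun i _ =>
      ((hidL i).integrable_sq.const_mul (4 * a i ^ 2))]
    refine Finset.sum_congr rfl fun i _ => ?_
    rw [integral_const_mul]
    congr 1
    rw [hν, integral_comp_eval (μ := fun _ : Fin N => gaussianReal 0 v) (i := i)
      (f := fun t => t ^ 2) (by fun_prop)]
    exact integral_sq_gaussianReal v
  have hF : ∀ (c : ℝ) (d : Fin N → ℝ),
      ∫ x, ((u x - c) ^ 2 + (u x - c - ∑ j, d j * x j) ^ 2) ∂(gaussScaled N lam) =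
        ∫ y, ((w y - c) ^ 2 + (w y - c - ∑ j, d j * y j) ^ 2) ∂ν := fun c d => by
    rw [hchange _ (by fun_prop)]
    simp only [hwu]
  have hinf : (⨅ (c : ℝ) (d : Fin N → ℝ),
      ∫ x, ((u x - c) ^ 2 + (u x - c - ∑ j, d j * x j) ^ 2) ∂(gaussScaled N lam)) =
        ∫ y, 2 * w y ^ 2 ∂ν := by
    simp only [hF]
    have hle := fun (c : ℝ) (d : Fin N → ℝ) =>
      integral_two_mul_sq_le hwL (hlinL d) hw0 (horth d) c
    have hle' := fun c : ℝ => le_ciInf (hle c)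
    refine le_antisymm ?_ (le_ciInf hle')
    refine (ciInf_le ⟨_, Set.forall_mem_range.mpr hle'⟩ 0).trans
      ((ciInf_le ⟨_, Set.forall_mem_range.mpr (hle 0)⟩ 0).trans_eq ?_)
    refine integral_congr_ae (ae_of_all _ fun y => ?_)
    simp only [sub_zero, Pi.zero_apply, zero_mul, Finset.sum_const_zero]
    ring
  rw [hgrad, hinf, integral_const_mul, hw2, hvc, Finset.mul_sum, Finset.mul_sum]
  refine Finset.sum_congr rfl fun i _ => ?_
  field_simp
  ring
end

section
/- Let L_A := Δ − x·∇ + Σ_{i=1}^N (α_i/x_i) ∂_i be the diffusion operator associated with the monomial Gaussian measure, with carré du champ Γ_A(u) := (1/2)[L_A(u²) − 2u L_A u] and iterated operator Γ₂(u) := (1/2)[L_A Γ_A(u) − 2 Γ_A(u, L_A u)]. Then for every smooth function u on ℝ^N_* one has the identities Γ_A(u) = |∇u|² and Γ₂(u) = ‖∇²u‖_F² + |∇u|² + Σ_{i=1}^N α_i (∂_i u)² / x_i², where ‖∇²u‖_F is the Frobenius norm of the Hessian; in particular Γ₂(u) ≥ Γ_A(u), so the monomial Gaussian measure satisfies the curvature-dimension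 condition CD(1, ∞). -/
open MeasureTheory Real

noncomputable section

/-- The Weyl chamber associated to the monomial weight with exponents `α`. -/
def chamber {N : ℕ} (α : Fin N → ℝ) : Set (EuclideanSpace ℝ (Fin N)) :=
  {x | ∀ i, 0 < α i → 0 < x i}

/-- The partial derivative `∂_i f`. -/
def pd {N : ℕ} (i : Fin N) (f : EuclideanSpace ℝ (Fin N) → ℝ) :
    EuclideanSpace ℝ (Fin N) → ℝ :=
  fun x => fderiv ℝ f x (EuclideanSpace.single i 1)

/-- The diffusion operator `L_A = Δ − x·∇ + Σ_i (α_i/x_i) ∂_i` associated with the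
monomial Gaussian measure. -/
def LA {N : ℕ} (α : Fin N → ℝ) (f : EuclideanSpace ℝ (Fin N) → ℝ) :
    EuclideanSpace ℝ (Fin N) → ℝ :=
  fun x => (∑ i, pd i (pd i f) x) - (∑ i, x i * pd i f x) + ∑ i, (α i / x i) * pd i f x

/-- The carré du champ operator `Γ_A(f,g) = (1/2)[L_A(fg) − f L_A g − g L_A f]`. -/
def GammaA {N : ℕ} (α : Fin N → ℝ) (f g : EuclideanSpace ℝ (Fin N) → ℝ) :
    EuclideanSpace ℝ (Fin N) → ℝ :=
  fun x => (1 / 2) * (LA α (fun y => f y * g y) x - f x * LA α g x - g x * LA α f x)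

/-- The iterated carré du champ operator `Γ₂(f) = (1/2)[L_A Γ_A(f) − 2 Γ_A(f, L_A f)]`. -/
def Gamma2 {N : ℕ} (α : Fin N → ℝ) (f : EuclideanSpace ℝ (Fin N) → ℝ) :
    EuclideanSpace ℝ (Fin N) → ℝ :=
  fun x => (1 / 2) * (LA α (GammaA α f f) x - 2 * GammaA α f (LA α f) x)

end

namespace MonomialGaussian

variable {N : ℕ} {α : Fin N → ℝ} {f g : EuclideanSpace ℝ (Fin N) → ℝ}
  {x : EuclideanSpace ℝ (Fin N)}

lemma two_le_infty : (2 : WithTop ℕ∞) ≤ ((⊤ : ℕ∞) : WithTop ℕ∞) :=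
  WithTop.coe_le_coe.2 (le_top : (2 : ℕ∞) ≤ ⊤)

lemma contDiffAt_pd {n m : WithTop ℕ∞} (hf : ContDiffAt ℝ n f x) (hmn : m + 1 ≤ n)
    (i : Fin N) : ContDiffAt ℝ m (pd i f) x :=
  (hf.fderiv_right hmn).clm_apply contDiffAt_const

lemma contDiff_pd (hf : ContDiff ℝ (⊤ : ℕ∞) f) (i : Fin N) :
    ContDiff ℝ (⊤ : ℕ∞) (pd i f) :=
  contDiff_iff_contDiffAt.2 fun _ => contDiffAt_pd hf.contDiffAt le_rfl i

lemma pd_add (i : Fin N) (hf : DifferentiableAt ℝ f x) (hg : DifferentiableAt ℝ g x) :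
    pd i (fun y => f y + g y) x = pd i f x + pd i g x := by
  simp [pd, fderiv_fun_add hf hg]

lemma pd_sub (i : Fin N) (hf : DifferentiableAt ℝ f x) (hg : DifferentiableAt ℝ g x) :
    pd i (fun y => f y - g y) x = pd i f x - pd i g x := by
  simp [pd, fderiv_fun_sub hf hg]

lemma pd_mul (i : Fin N) (hf : DifferentiableAt ℝ f x) (hg : DifferentiableAt ℝ g x) :
    pd i (fun y => f y * g y) x = f x * pd i g x + g x * pd i f x := by
  simp [pd, fderiv_fun_mul hf hg]

lemma pd_sum {ι : Type*} (s : Finset ι) {F : ι → EuclideanSpace ℝ (Fin N) → ℝ} (i : Fin N)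
    (hF : ∀ j ∈ s, DifferentiableAt ℝ (F j) x) :
    pd i (fun y => ∑ j ∈ s, F j y) x = ∑ j ∈ s, pd i (F j) x := by
  simp [pd, fderiv_fun_sum hF]

lemma pd_congr (i : Fin N) (h : f =ᶠ[nhds x] g) : pd i f x = pd i g x := by
  simp [pd, h.fderiv_eq]

lemma hasFDerivAt_coord (i : Fin N) :
    HasFDerivAt (fun y : EuclideanSpace ℝ (Fin N) => y i)
      (EuclideanSpace.proj i : EuclideanSpace ℝ (Fin N) →L[ℝ] ℝ) x :=
  (EuclideanSpace.proj i : EuclideanSpace ℝ (Fin N) →L[ℝ] ℝ).hasFDerivAt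

lemma contDiff_coord {n : WithTop ℕ∞} (i : Fin N) :
    ContDiff ℝ n (fun y : EuclideanSpace ℝ (Fin N) => y i) :=
  (EuclideanSpace.proj i : EuclideanSpace ℝ (Fin N) →L[ℝ] ℝ).contDiff

lemma pd_coord (i j : Fin N) :
    pd j (fun y : EuclideanSpace ℝ (Fin N) => y i) x = if i = j then 1 else 0 := by
  simp [pd, (hasFDerivAt_coord i).fderiv]

lemma contDiffAt_const_div_coord {n : WithTop ℕ∞} {a : ℝ} {i : Fin N} (h : a = 0 ∨ x i ≠ 0) :
    ContDiffAt ℝ n (fun y : EuclideanSpace ℝ (Fin N) => a / y i) x := by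
  rcases h with rfl | h
  · simpa using contDiffAt_const
  · exact contDiffAt_const.div (contDiff_coord i).contDiffAt h

lemma pd_const_div_coord {a : ℝ} {i : Fin N} (j : Fin N) (h : a = 0 ∨ x i ≠ 0) :
    pd j (fun y : EuclideanSpace ℝ (Fin N) => a / y i) x =
      if i = j then -(a / x i ^ 2) else 0 := by
  rcases h with rfl | h
  · simp [pd]
  · have hd := ((hasDerivAt_inv h).comp_hasFDerivAt x (hasFDerivAt_coord i)).const_mul a
    have hd' : HasFDerivAt (fun y : EuclideanSpace ℝ (Fin N) => a / y i) _ x := hd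
    rw [pd, hd'.fderiv]
    split_ifs with hij <;> simp [hij, div_eq_mul_inv]

lemma pd_pd_comm (hf : ContDiffAt ℝ 2 f x) (i j : Fin N) :
    pd i (pd j f) x = pd j (pd i f) x := by
  have hd : DifferentiableAt ℝ (fderiv ℝ f) x :=
    (hf.fderiv_right (m := 1) (by norm_num)).differentiableAt (by norm_num)
  have key : ∀ k l : Fin N, pd k (pd l f) x =
      fderiv ℝ (fderiv ℝ f) x (EuclideanSpace.single k 1) (EuclideanSpace.single l 1) := by
    intro k l
    change fderiv ℝ (fun y => fderiv ℝ f y (EuclideanSpace.single l 1)) x _ = _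
    rw [fderiv_clm_apply hd (differentiableAt_const _)]
    simp
  rw [key, key]
  exact (hf.isSymmSndFDerivAt (by simp)).eq _ _

lemma eventually_differentiableAt (hf : ContDiffAt ℝ 2 f x) :
    ∀ᶠ y in nhds x, DifferentiableAt ℝ f y :=
  (hf.eventually (by simp)).mono fun _ h => h.differentiableAt (by norm_num)

lemma differentiableAt_pd (hf : ContDiffAt ℝ 2 f x) (i : Fin N) :
    DifferentiableAt ℝ (pd i f) x :=
  (contDiffAt_pd (m := 1) hf (by norm_num) i).differentiableAt (by norm_num)

lemma pd_pd_mul (hf : ContDiffAt ℝ 2 f x) (hg : ContDiffAt ℝ 2 g x) (i : Fin N) :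
    pd i (pd i fun y => f y * g y) x =
      f x * pd i (pd i g) x + g x * pd i (pd i f) x + 2 * (pd i f x * pd i g x) := by
  have h : pd i (fun y => f y * g y) =ᶠ[nhds x] fun y => f y * pd i g y + g y * pd i f y := by
    filter_upwards [eventually_differentiableAt hf, eventually_differentiableAt hg] with y h1 h2
    exact pd_mul i h1 h2
  have hf1 := hf.differentiableAt (by norm_num)
  have hg1 := hg.differentiableAt (by norm_num)
  have hfi := differentiableAt_pd hf i
  have hgi := differentiableAt_pd hg i
  rw [pd_congr i h, pd_add i (hf1.fun_mul hgi) (hg1.fun_mul hfi), pd_mul i hf1 hgi,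
    pd_mul i hg1 hfi]
  ring

lemma LA_eq_sum : LA α f x = ∑ i, (pd i (pd i f) x - x i * pd i f x + α i / x i * pd i f x) := by
  simp only [LA, Finset.sum_add_distrib, Finset.sum_sub_distrib]

/-- The carré du champ is the product of the gradients. -/
lemma GammaA_eq (hf : ContDiffAt ℝ 2 f x) (hg : ContDiffAt ℝ 2 g x) :
    GammaA α f g x = ∑ i, pd i f x * pd i g x := by
  rw [GammaA, LA_eq_sum, LA_eq_sum, LA_eq_sum, Finset.mul_sum, Finset.mul_sum,
    ← Finset.sum_sub_distrib, ← Finset.sum_sub_distrib, Finset.mul_sum]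
  refine Finset.sum_congr rfl fun i _ => ?_
  rw [pd_pd_mul hf hg, pd_mul i (hf.differentiableAt (by norm_num))
    (hg.differentiableAt (by norm_num))]
  ring

lemma LA_sum {ι : Type*} (s : Finset ι) {F : ι → EuclideanSpace ℝ (Fin N) → ℝ}
    (hF : ∀ j ∈ s, ContDiff ℝ 2 (F j)) :
    LA α (fun y => ∑ j ∈ s, F j y) x = ∑ j ∈ s, LA α (F j) x := by
  have h1 : ∀ i, pd i (fun y => ∑ j ∈ s, F j y) = fun y => ∑ j ∈ s, pd i (F j) y := fun i =>
    funext fun y => pd_sum s i fun j hj => (hF j hj).differentiable (by norm_num) y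
  have h2 : ∀ i, pd i (fun y => ∑ j ∈ s, pd i (F j) y) x = ∑ j ∈ s, pd i (pd i (F j)) x :=
    fun i => pd_sum s i fun j hj => differentiableAt_pd (hF j hj).contDiffAt i
  simp only [LA_eq_sum, h1, h2]
  rw [Finset.sum_comm]
  simp only [Finset.sum_add_distrib, Finset.sum_sub_distrib, Finset.mul_sum]

lemma LA_mul_self (hf : ContDiffAt ℝ 2 f x) :
    LA α (fun y => f y * f y) x = 2 * (f x * LA α f x) + 2 * ∑ i, pd i f x ^ 2 := by
  have h := GammaA_eq (α := α) hf hf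
  simp only [← pow_two (pd _ f x)] at h
  rw [← h, GammaA]
  ring

lemma contDiffAt_LA (hf : ContDiff ℝ (⊤ : ℕ∞) f) (h : ∀ i, α i = 0 ∨ x i ≠ 0) :
    ContDiffAt ℝ 2 (LA α f) x := by
  have h2 := two_le_infty
  have h1 i : ContDiffAt ℝ 2 (pd i f) x := ((contDiff_pd hf i).of_le h2).contDiffAt
  refine ((ContDiffAt.sum fun i _ => ?_).sub (ContDiffAt.sum fun i _ => ?_)).add
    (ContDiffAt.sum fun i _ => ?_)
  · exact ((contDiff_pd (contDiff_pd hf i) i).of_le h2).contDiffAt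
  · exact (contDiff_coord i).contDiffAt.mul (h1 i)
  · exact (contDiffAt_const_div_coord (h i)).mul (h1 i)

/-- The commutator of `∂_j` with `L_A`. -/
lemma pd_LA (hf : ContDiff ℝ (⊤ : ℕ∞) f) (h : ∀ i, α i = 0 ∨ x i ≠ 0) (j : Fin N) :
    pd j (LA α f) x = LA α (pd j f) x - pd j f x - α j / x j ^ 2 * pd j f x := by
  have h2 := two_le_infty
  have hs : ∀ {v : EuclideanSpace ℝ (Fin N) → ℝ}, ContDiff ℝ (⊤ : ℕ∞) v →
      DifferentiableAt ℝ v x := fun hv => (hv.of_le h2).contDiffAt.differentiableAt (by norm_num)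
  have hc : ∀ {v : EuclideanSpace ℝ (Fin N) → ℝ}, ContDiff ℝ (⊤ : ℕ∞) v →
      ∀ i k, pd i (pd k v) = pd k (pd i v) := fun hv i k =>
    funext fun y => pd_pd_comm (hv.of_le h2).contDiffAt i k
  have d1 i : DifferentiableAt ℝ (pd i f) x := hs (contDiff_pd hf i)
  have d2 i : DifferentiableAt ℝ (pd i (pd i f)) x := hs (contDiff_pd (contDiff_pd hf i) i)
  have dc i : DifferentiableAt ℝ (fun y : EuclideanSpace ℝ (Fin N) => y i) x :=
    (hasFDerivAt_coord i).differentiableAt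
  have dd i : DifferentiableAt ℝ (fun y : EuclideanSpace ℝ (Fin N) => α i / y i) x :=
    (contDiffAt_const_div_coord (n := 1) (h i)).differentiableAt (by norm_num)
  have e : LA α f = fun y => ∑ i, (pd i (pd i f) y - y i * pd i f y + α i / y i * pd i f y) :=
    funext fun _ => LA_eq_sum
  have e1 i : pd j (fun y => pd i (pd i f) y - y i * pd i f y + α i / y i * pd i f y) x =
      (pd i (pd i (pd j f)) x - x i * pd i (pd j f) x + α i / x i * pd i (pd j f) x) -
        (if i = j then pd i f x + α i / x i ^ 2 * pd i f x else 0) := by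
    rw [pd_add j ((d2 i).fun_sub ((dc i).fun_mul (d1 i))) ((dd i).fun_mul (d1 i)),
      pd_sub j (d2 i) ((dc i).fun_mul (d1 i)), pd_mul j (dc i) (d1 i), pd_mul j (dd i) (d1 i),
      pd_coord, pd_const_div_coord j (h i), hc (contDiff_pd hf i) j i, hc hf j i]
    split_ifs <;> ring
  rw [e, pd_sum _ _ fun i _ =>
    ((d2 i).fun_sub ((dc i).fun_mul (d1 i))).fun_add ((dd i).fun_mul (d1 i)), LA_eq_sum]
  simp only [e1]
  rw [Finset.sum_sub_distrib, Finset.sum_ite_eq' Finset.univ j]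
  simp only [Finset.mem_univ, if_true]
  ring

/-- The Bochner formula for `L_A`. -/
lemma Gamma2_eq (hf : ContDiff ℝ (⊤ : ℕ∞) f) (h : ∀ i, α i = 0 ∨ x i ≠ 0) :
    Gamma2 α f x = (∑ i, ∑ j, (pd i (pd j f) x) ^ 2) + (∑ i, (pd i f x) ^ 2) +
      ∑ i, α i * (pd i f x) ^ 2 / (x i) ^ 2 := by
  have h2 := two_le_infty
  have hf2 := hf.of_le h2
  have d i : ContDiff ℝ 2 (pd i f) := (contDiff_pd hf i).of_le h2
  have e : GammaA α f f = fun y => ∑ i, pd i f y * pd i f y :=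
    funext fun y => GammaA_eq hf2.contDiffAt hf2.contDiffAt
  rw [Gamma2, e, LA_sum _ fun i _ => (d i).mul (d i),
    GammaA_eq hf2.contDiffAt (contDiffAt_LA hf h),
    Finset.sum_comm (f := fun i j => (pd i (pd j f) x) ^ 2), Finset.mul_sum,
    ← Finset.sum_sub_distrib, Finset.mul_sum, ← Finset.sum_add_distrib, ← Finset.sum_add_distrib]
  refine Finset.sum_congr rfl fun j _ => ?_
  rw [LA_mul_self (d j).contDiffAt, pd_LA hf h j]
  ring

end MonomialGaussian

/-- Bakry–Émery `Γ`-calculus for the monomial Gaussian measure: for smooth `u` on the Weyl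
chamber, `Γ_A(u) = |∇u|²` and `Γ₂(u) = ‖∇²u‖_F² + |∇u|² + Σ_i α_i (∂_i u)²/x_i²`; in
particular `Γ₂(u) ≥ Γ_A(u)`, i.e. the curvature-dimension condition `CD(1, ∞)` holds. -/
theorem gamma_calculus_monomial_gaussian {N : ℕ} (α : Fin N → ℝ) (hα : ∀ i, 0 ≤ α i)
    (u : EuclideanSpace ℝ (Fin N) → ℝ) (hu : ContDiff ℝ (⊤ : ℕ∞) u)
    (x : EuclideanSpace ℝ (Fin N)) (hx : x ∈ chamber α) :
    GammaA α u u x = ∑ i, (pd i u x) ^ 2 ∧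
    Gamma2 α u x = (∑ i, ∑ j, (pd i (pd j u) x) ^ 2) + (∑ i, (pd i u x) ^ 2) +
      ∑ i, α i * (pd i u x) ^ 2 / (x i) ^ 2 ∧
    Gamma2 α u x ≥ GammaA α u u x := by
  have h2 : ContDiffAt ℝ 2 u x := hu.contDiffAt.of_le MonomialGaussian.two_le_infty
  have hG : GammaA α u u x = ∑ i, (pd i u x) ^ 2 := by
    simpa only [pow_two] using MonomialGaussian.GammaA_eq h2 h2
  have hG2 := MonomialGaussian.Gamma2_eq hu fun i =>
    (hα i).eq_or_lt.imp Eq.symm fun hi => (hx i hi).ne'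
  refine ⟨hG, hG2, ?_⟩
  have hH : 0 ≤ ∑ i, ∑ j, (pd i (pd j u) x) ^ 2 := by positivity
  have hW : 0 ≤ ∑ i, α i * (pd i u x) ^ 2 / (x i) ^ 2 := Finset.sum_nonneg fun i _ =>
    div_nonneg (mul_nonneg (hα i) (sq_nonneg _)) (sq_nonneg _)
  rw [ge_iff_le, hG, hG2]
  linarith
end
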